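/- arXiv:2401.01274 — 2 statements merged into one kernel-verified Lean document; each statement's English description precedes it below -/
import Mathlib

section
/- Let m₁, m₂ be positive integers with ((√5 + 1)/2)·m₂ < m₁ < 3·m₂. Then the two-colour Ramsey number of the double star S(m₁, m₂) satisfies R(S(m₁, m₂)) ≤ ⌈√(2m₁² + (m₁ + m₂/2)²) + m₂/2⌉ + 1. -/
open SimpleGraph

/-- `G` contains a copy of `H` as a subgraph, i.e. there is an injective graph
homomorphism from `H` to `G`. -/
def Contains {V W : Type*} (G : SimpleGraph V) (H : SimpleGraph W) : Prop :=
  ∃ f : H →g G, Function.Injective f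

/-- The double star `S(m₁, m₂)`: two adjacent centres `0` and `1`, where centre `0`
has `m₁` leaves (the vertices `2, …, m₁ + 1`) and centre `1` has `m₂` leaves
(the vertices `m₁ + 2, …, m₁ + m₂ + 1`). -/
def DoubleStar (m₁ m₂ : ℕ) : SimpleGraph (Fin (m₁ + m₂ + 2)) :=
  SimpleGraph.fromRel (fun i j =>
    (i.val = 0 ∧ 0 < j.val ∧ j.val < m₁ + 2) ∨ (i.val = 1 ∧ m₁ + 2 ≤ j.val))

/-- The two-colour Ramsey number of `H`: the least `n` such that every red/blue
colouring of the edges of `K_n` (encoded by the red graph `G`, blue being its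
complement) contains a monochromatic copy of `H`. -/
noncomputable def ramseyNumber {W : Type*} (H : SimpleGraph W) : ℕ :=
  sInf {n : ℕ | ∀ G : SimpleGraph (Fin n), Contains G H ∨ Contains Gᶜ H}

open Finset in
theorem Finset.exists_disjoint_subsets_card {V : Type*} [DecidableEq V] (P Q : Finset V) (a b : ℕ)
    (hP : a ≤ #P) (hQ : b ≤ #Q) (hPQ : a + b ≤ #(P ∪ Q)) :
    ∃ A ⊆ P, ∃ B ⊆ Q, Disjoint A B ∧ #A = a ∧ #B = b := by
  have hU : #(P ∪ Q) = #P + #(Q \ P) := by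
    rw [← card_union_of_disjoint disjoint_sdiff, union_sdiff_self_eq_union]
  rcases le_total b #(Q \ P) with h | h
  · obtain ⟨B, hB, hBc⟩ := exists_subset_card_eq h
    obtain ⟨A, hA, hAc⟩ := exists_subset_card_eq hP
    exact ⟨A, hA, B, hB.trans sdiff_subset,
      (disjoint_sdiff.mono_left hA).mono_right hB, hAc, hBc⟩
  · obtain ⟨B, hB₁, hB₂, hBc⟩ := exists_subsuperset_card_eq (sdiff_subset (s := Q) (t := P)) h hQ
    have hsub : P ∪ Q ⊆ (P \ B) ∪ B := by
      intro x hx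
      by_cases hxB : x ∈ B
      · simp [hxB]
      · have : x ∉ Q \ P := fun h => hxB (hB₁ h)
        simp only [mem_union, mem_sdiff] at *
        tauto
    have hcard := (card_le_card hsub).trans (card_union_le _ _)
    obtain ⟨A, hA, hAc⟩ := exists_subset_card_eq (show a ≤ #(P \ B) by omega)
    exact ⟨A, hA.trans sdiff_subset, B, hB₂, disjoint_sdiff.symm.mono_left hA, hAc, hBc⟩

theorem SimpleGraph.adj_or_adj_of_isCompl {V : Type*} {G H : SimpleGraph V} (hGH : IsCompl G H)
    {u v : V} (huv : u ≠ v) : G.Adj u v ∨ H.Adj u v := by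
  rw [← SimpleGraph.sup_adj, hGH.sup_eq_top]
  exact huv

theorem SimpleGraph.Adj.not_adj_of_isCompl {V : Type*} {G H : SimpleGraph V} {u v : V}
    (h : G.Adj u v) (hGH : IsCompl G H) : ¬ H.Adj u v := fun h' => by
  have : (G ⊓ H).Adj u v := ⟨h, h'⟩
  rw [hGH.inf_eq_bot] at this
  exact this

theorem degree_add_degree_of_isCompl {V : Type*} {G H : SimpleGraph V} [Fintype V]
    [DecidableRel G.Adj] [DecidableRel H.Adj] (hGH : IsCompl G H) (v : V) :
    G.degree v + H.degree v + 1 = Fintype.card V := by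
  classical
  obtain rfl := hGH.compl_eq
  have h := G.degree_compl v
  have hlt := G.degree_lt_card_verts v
  have : Gᶜ.degree v = Fintype.card V - 1 - G.degree v := by
    convert h
  omega

theorem disjoint_neighborFinset_of_isCompl {V : Type*} {G H : SimpleGraph V} [Fintype V]
    [DecidableRel G.Adj] [DecidableRel H.Adj] (hGH : IsCompl G H) (v : V) :
    Disjoint (G.neighborFinset v) (H.neighborFinset v) := by
  rw [Finset.disjoint_left]
  intro x hx hx'
  rw [SimpleGraph.mem_neighborFinset] at hx hx'
  exact hx.not_adj_of_isCompl hGH hx'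

section DoubleStarRamsey

open Finset

variable {V : Type*} {G H : SimpleGraph V} {m₁ m₂ k : ℕ}

theorem contains_doubleStar_of_leaves {u v : V} (huv : G.Adj u v) {A B : Finset V}
    (hA : ∀ x ∈ A, G.Adj u x ∧ x ≠ v) (hB : ∀ x ∈ B, G.Adj v x ∧ x ≠ u) (hAB : Disjoint A B)
    (hAc : #A = m₁) (hBc : #B = m₂) : Contains G (DoubleStar m₁ m₂) := by
  let a : Fin m₁ → V := fun i => (A.equivFinOfCardEq hAc).symm i
  let b : Fin m₂ → V := fun i => (B.equivFinOfCardEq hBc).symm i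
  have ha : ∀ i, a i ∈ A := fun i => ((A.equivFinOfCardEq hAc).symm i).2
  have hb : ∀ i, b i ∈ B := fun i => ((B.equivFinOfCardEq hBc).symm i).2
  have ha_inj : ∀ i j, a i = a j → i = j := fun i j h =>
    (A.equivFinOfCardEq hAc).symm.injective (Subtype.ext h)
  have hb_inj : ∀ i j, b i = b j → i = j := fun i j h =>
    (B.equivFinOfCardEq hBc).symm.injective (Subtype.ext h)
  have hab : ∀ i j, a i ≠ b j := fun i j h => disjoint_left.1 hAB (ha i) (h ▸ hb j)
  have hau : ∀ i, a i ≠ u := fun i h => (hA _ (ha i)).1.ne h.symm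
  have hbv : ∀ i, b i ≠ v := fun i h => (hB _ (hb i)).1.ne h.symm
  have hav : ∀ i, a i ≠ v := fun i => (hA _ (ha i)).2
  have hbu : ∀ i, b i ≠ u := fun i => (hB _ (hb i)).2
  let f : Fin (m₁ + m₂ + 2) → V := fun i =>
    if h₀ : i.val = 0 then u else if h₁ : i.val = 1 then v else
      if h : i.val - 2 < m₁ then a ⟨i.val - 2, h⟩ else
        b ⟨i.val - 2 - m₁, by omega⟩
  have hf : ∀ i j : Fin (m₁ + m₂ + 2),
      (i.val = 0 ∧ 0 < j.val ∧ j.val < m₁ + 2) ∨ (i.val = 1 ∧ m₁ + 2 ≤ j.val) →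
        G.Adj (f i) (f j) := by
    rintro i j (⟨hi, hj₀, hj⟩ | ⟨hi, hj⟩)
    · by_cases hj₁ : j.val = 1
      · simp only [f]
        rwa [dif_pos hi, dif_neg hj₀.ne', dif_pos hj₁]
      · have : j.val - 2 < m₁ := by omega
        simp only [f]
        rw [dif_pos hi, dif_neg hj₀.ne', dif_neg hj₁, dif_pos this]
        exact (hA _ (ha _)).1
    · have h₀ : j.val ≠ 0 := by omega
      have h₁ : j.val ≠ 1 := by omega
      have h₂ : ¬ j.val - 2 < m₁ := by omega
      have hi₀ : i.val ≠ 0 := by omega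
      simp only [f]
      rw [dif_neg hi₀, dif_pos hi, dif_neg h₀, dif_neg h₁, dif_neg h₂]
      exact (hB _ (hb _)).1
  refine ⟨⟨f, ?_⟩, ?_⟩
  · intro i j hij
    rw [DoubleStar, SimpleGraph.fromRel_adj] at hij
    exact hij.2.elim (hf i j) fun h => (hf j i h).symm
  · intro i j hij
    change f i = f j at hij
    apply Fin.ext
    dsimp only [f] at hij
    split_ifs at hij
    all_goals first
      | omega
      | exact absurd hij huv.ne
      | exact absurd hij huv.ne'
      | exact absurd hij (hau _)
      | exact absurd hij (hav _)
      | exact absurd hij (hbu _)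
      | exact absurd hij (hbv _)
      | exact absurd hij.symm (hau _)
      | exact absurd hij.symm (hav _)
      | exact absurd hij.symm (hbu _)
      | exact absurd hij.symm (hbv _)
      | exact absurd hij (hab _ _)
      | exact absurd hij.symm (hab _ _)
      | (have := congrArg Fin.val (ha_inj _ _ hij); simp only at this; omega)
      | (have := congrArg Fin.val (hb_inj _ _ hij); simp only at this; omega)

variable [Fintype V] [DecidableEq V] [DecidableRel G.Adj]

theorem contains_doubleStar_of_card_union {u v : V} (huv : G.Adj u v)
    (hu : m₁ < G.degree u) (hv : m₂ < G.degree v)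
    (hU : m₁ + m₂ + 2 ≤ #(G.neighborFinset u ∪ G.neighborFinset v)) :
    Contains G (DoubleStar m₁ m₂) := by
  have hvu : v ∈ G.neighborFinset u := by simpa using huv
  have huv' : u ∈ G.neighborFinset v := by simpa using huv.symm
  have hsub : G.neighborFinset u ∪ G.neighborFinset v ⊆
      ((G.neighborFinset u).erase v ∪ (G.neighborFinset v).erase u) ∪ {u, v} := by
    intro x hx
    simp only [mem_union, mem_erase, mem_insert, mem_singleton] at *
    tauto
  have hc := (card_le_card hsub).trans (card_union_le _ _)
  have h2 : #({u, v} : Finset V) ≤ 2 := card_le_two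
  obtain ⟨A, hA, B, hB, hAB, hAc, hBc⟩ := Finset.exists_disjoint_subsets_card
    ((G.neighborFinset u).erase v) ((G.neighborFinset v).erase u) m₁ m₂
    (by rw [card_erase_of_mem hvu, SimpleGraph.card_neighborFinset_eq_degree]; omega)
    (by rw [card_erase_of_mem huv', SimpleGraph.card_neighborFinset_eq_degree]; omega)
    (by omega)
  refine contains_doubleStar_of_leaves huv (fun x hx => ?_) (fun x hx => ?_) hAB hAc hBc
  · simpa [and_comm] using hA hx
  · simpa [and_comm] using hB hx

theorem card_neighborFinset_union_le (hG : ¬ Contains G (DoubleStar m₁ m₂)) {u v : V}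
    (huv : G.Adj u v) (hu : m₁ < G.degree u) (hv : m₂ < G.degree v) :
    #(G.neighborFinset u ∪ G.neighborFinset v) ≤ m₁ + m₂ + 1 := by
  by_contra! h
  exact hG (contains_doubleStar_of_card_union huv hu hv h)

theorem sum_card_inter_neighborFinset_comm (A B : Finset V) :
    ∑ v ∈ A, #(G.neighborFinset v ∩ B) = ∑ w ∈ B, #(G.neighborFinset w ∩ A) := by
  have h := sum_card_bipartiteAbove_eq_sum_card_bipartiteBelow (s := A) (t := B) G.Adj
  convert h using 2 with v _ w _
  · congr 1
    ext x
    simp [bipartiteAbove, and_comm]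
  · congr 1
    ext x
    simp [bipartiteBelow, and_comm, G.adj_comm]

variable [DecidableRel H.Adj]

theorem lt_degree_of_no_doubleStar (hm₁ : 0 < m₁) (hGH : IsCompl G H)
    (hG : ¬ Contains G (DoubleStar m₁ m₂)) (hH : ¬ Contains H (DoubleStar m₁ m₂))
    (hcard : m₁ + 2 * m₂ + 2 ≤ Fintype.card V) (w : V) :
    m₂ < G.degree w := by
  by_contra! hw
  have hsmall : ∀ v, H.Adj w v → H.degree v ≤ m₂ := by
    intro v hv
    by_contra! hv'
    have hdeg := degree_add_degree_of_isCompl hGH w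
    have hle := card_neighborFinset_union_le hH hv (by omega) hv'
    have hsub : insert w (H.neighborFinset w) ⊆ H.neighborFinset w ∪ H.neighborFinset v := by
      intro x hx
      rcases mem_insert.1 hx with rfl | hx
      · simp [hv.symm]
      · exact mem_union_left _ hx
    have := card_le_card hsub
    rw [card_insert_of_notMem (by simp), SimpleGraph.card_neighborFinset_eq_degree] at this
    omega
  have hdeg := degree_add_degree_of_isCompl hGH w
  obtain ⟨v, hv⟩ : (H.neighborFinset w).Nonempty := by
    rw [← card_pos, SimpleGraph.card_neighborFinset_eq_degree]
    omega
  rw [SimpleGraph.mem_neighborFinset] at hv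
  obtain ⟨v', hv', hvv'⟩ : ∃ v' ∈ H.neighborFinset w, v' ∉ insert v (H.neighborFinset v) := by
    apply exists_mem_notMem_of_card_lt_card
    have h₁ := card_insert_le v (H.neighborFinset v)
    have h₂ := hsmall v hv
    rw [SimpleGraph.card_neighborFinset_eq_degree] at h₁ ⊢
    omega
  rw [SimpleGraph.mem_neighborFinset] at hv'
  simp only [mem_insert, SimpleGraph.mem_neighborFinset, not_or] at hvv'
  have hadj : G.Adj v v' :=
    (SimpleGraph.adj_or_adj_of_isCompl hGH (Ne.symm hvv'.1)).resolve_right hvv'.2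
  have h₁ := hsmall v hv
  have h₂ := hsmall v' hv'
  have d₁ := degree_add_degree_of_isCompl hGH v
  have d₂ := degree_add_degree_of_isCompl hGH v'
  have hle := card_neighborFinset_union_le hG hadj (by omega) (by omega)
  have hsub : insert v (G.neighborFinset v) ⊆ G.neighborFinset v ∪ G.neighborFinset v' := by
    intro x hx
    rcases mem_insert.1 hx with rfl | hx
    · simp [hadj.symm]
    · exact mem_union_left _ hx
  have := card_le_card hsub
  rw [card_insert_of_notMem (by simp), SimpleGraph.card_neighborFinset_eq_degree] at this
  omega

theorem le_card_inter_neighborFinset (hm₁ : 0 < m₁) (hGH : IsCompl G H)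
    (hG : ¬ Contains G (DoubleStar m₁ m₂)) (hH : ¬ Contains H (DoubleStar m₁ m₂))
    (hcard : m₁ + 2 * m₂ + 2 ≤ Fintype.card V) (hk : m₁ + m₂ + k + 1 = Fintype.card V)
    {u v : V} (huv : G.Adj u v) (hu : m₁ < G.degree u) :
    k ≤ #(H.neighborFinset u ∩ H.neighborFinset v) := by
  have hle := card_neighborFinset_union_le hG huv hu
    (lt_degree_of_no_doubleStar hm₁ hGH hG hH hcard v)
  have hsub : (G.neighborFinset u ∪ G.neighborFinset v)ᶜ ⊆
      H.neighborFinset u ∩ H.neighborFinset v := by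
    intro x hx
    simp only [mem_compl, mem_union, SimpleGraph.mem_neighborFinset, not_or] at hx
    have hux : u ≠ x := by
      rintro rfl
      exact hx.2 huv.symm
    have hvx : v ≠ x := by
      rintro rfl
      exact hx.1 huv
    simp only [mem_inter, SimpleGraph.mem_neighborFinset]
    exact ⟨(SimpleGraph.adj_or_adj_of_isCompl hGH hux).resolve_left hx.1,
      (SimpleGraph.adj_or_adj_of_isCompl hGH hvx).resolve_left hx.2⟩
  have := card_le_card hsub
  rw [card_compl] at this
  omega

/-- Any two `G`-adjacent vertices, the first of which has `G`-degree exceeding `m`, have at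
least `k` common `H`-neighbours. -/
def ManyCommonNeighbors (G H : SimpleGraph V) [DecidableRel G.Adj] [DecidableRel H.Adj]
    (m k : ℕ) : Prop :=
  ∀ ⦃u v : V⦄, G.Adj u v → m < G.degree u → k ≤ #(H.neighborFinset u ∩ H.neighborFinset v)

theorem degree_le_or_degree_le (hGH : IsCompl G H) (hP : ManyCommonNeighbors G H m₁ k)
    (hQ : ManyCommonNeighbors H G m₁ k) (hk : Fintype.card V ≤ 4 * k) (u : V) :
    G.degree u ≤ m₁ ∨ H.degree u ≤ m₁ := by
  by_contra! h
  obtain ⟨hGu, hHu⟩ := h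
  have hdeg := degree_add_degree_of_isCompl hGH u
  have hlow : #(G.neighborFinset u) * k ≤
      ∑ v ∈ G.neighborFinset u, #(H.neighborFinset v ∩ H.neighborFinset u) := by
    rw [← smul_eq_mul]
    refine card_nsmul_le_sum _ _ _ fun v hv => ?_
    rw [inter_comm]
    exact hP (by simpa using hv) hGu
  have hupp : ∑ c ∈ H.neighborFinset u, (#(H.neighborFinset c ∩ G.neighborFinset u) + k) ≤
      #(H.neighborFinset u) * G.degree u := by
    rw [← smul_eq_mul]
    refine sum_le_card_nsmul _ _ _ fun c hc => ?_
    have hc' : H.Adj u c := by simpa using hc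
    have h₁ := hQ hc' hHu
    have h₂ : #(H.neighborFinset c ∩ G.neighborFinset u) +
        #(G.neighborFinset u ∩ G.neighborFinset c) ≤ #(G.neighborFinset u) := by
      rw [← card_union_of_disjoint]
      · exact card_le_card (union_subset inter_subset_right inter_subset_left)
      · exact ((disjoint_neighborFinset_of_isCompl hGH c).symm.mono_left
          inter_subset_left).mono_right inter_subset_right
    rw [SimpleGraph.card_neighborFinset_eq_degree] at h₂
    omega
  rw [sum_card_inter_neighborFinset_comm] at hlow
  rw [sum_add_distrib, sum_const, smul_eq_mul] at hupp
  simp only [SimpleGraph.card_neighborFinset_eq_degree] at hlow hupp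
  nlinarith [four_mul_le_sq_add (G.degree u) (H.degree u)]

theorem exists_lt_degree_of_manyCommonNeighbors (hGH : IsCompl G H)
    (hP : ManyCommonNeighbors G H m₁ k) (hm : 2 * m₁ + 2 ≤ Fintype.card V)
    (hk : 2 * m₁ ^ 2 + k ≤ (Fintype.card V + m₁) * k) (hk₀ : 0 < k) [Nonempty V] :
    ∃ v, m₁ < H.degree v := by
  by_contra! hH
  have hG : ∀ v, m₁ < G.degree v := fun v => by
    have := degree_add_degree_of_isCompl hGH v
    have := hH v
    omega
  obtain ⟨u⟩ := ‹Nonempty V›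
  have hdeg := degree_add_degree_of_isCompl hGH u
  have hlow : #(G.neighborFinset u) * k ≤
      ∑ v ∈ G.neighborFinset u, #(H.neighborFinset v ∩ H.neighborFinset u) := by
    rw [← smul_eq_mul]
    refine card_nsmul_le_sum _ _ _ fun v hv => ?_
    rw [inter_comm]
    exact hP (by simpa using hv) (hG u)
  have hupp : ∑ c ∈ H.neighborFinset u, (#(H.neighborFinset c ∩ G.neighborFinset u) + 2 * k + 1) ≤
      #(H.neighborFinset u) * (2 * m₁) := by
    refine (sum_le_card_nsmul _ _ (2 * m₁) fun c hc => ?_).trans_eq (smul_eq_mul _ _)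
    have hc' : H.Adj u c := by simpa using hc
    obtain ⟨z, hz⟩ : ∃ z, z ∉ H.neighborFinset u ∪ H.neighborFinset c := by
      by_contra! h
      have h₁ : #(H.neighborFinset u ∪ H.neighborFinset c) = Fintype.card V := by
        rw [eq_univ_iff_forall.2 h, card_univ]
      have h₂ := card_union_le (H.neighborFinset u) (H.neighborFinset c)
      simp only [SimpleGraph.card_neighborFinset_eq_degree] at h₂
      have := hH u
      have := hH c
      omega
    simp only [mem_union, SimpleGraph.mem_neighborFinset, not_or] at hz
    have hzu : z ≠ u := by
      rintro rfl
      exact hz.2 hc'.symm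
    have hzc : z ≠ c := by
      rintro rfl
      exact hz.1 hc'
    have h₁ := hP ((SimpleGraph.adj_or_adj_of_isCompl hGH hzu).resolve_right
      fun h => hz.1 h.symm) (hG z)
    have h₂ := hP ((SimpleGraph.adj_or_adj_of_isCompl hGH hzc).resolve_right
      fun h => hz.2 h.symm) (hG z)
    have h₃ := card_union_add_card_inter (H.neighborFinset z ∩ H.neighborFinset u)
      (H.neighborFinset z ∩ H.neighborFinset c)
    have h₄ : #(H.neighborFinset z ∩ H.neighborFinset u ∪
        H.neighborFinset z ∩ H.neighborFinset c) ≤ #(H.neighborFinset z) :=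
      card_le_card (union_subset inter_subset_left inter_subset_left)
    have h₅ : #((H.neighborFinset z ∩ H.neighborFinset u) ∩
        (H.neighborFinset z ∩ H.neighborFinset c)) ≤
          #(H.neighborFinset c ∩ H.neighborFinset u) := by
      refine card_le_card fun x hx => ?_
      simp only [mem_inter] at *
      tauto
    have h₆ : #(H.neighborFinset c ∩ G.neighborFinset u) +
        #(insert u (H.neighborFinset c ∩ H.neighborFinset u)) ≤ #(H.neighborFinset c) := by
      rw [← card_union_of_disjoint]
      · refine card_le_card (union_subset inter_subset_left (insert_subset ?_ inter_subset_left))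
        simpa using hc'.symm
      · rw [disjoint_insert_right]
        exact ⟨by simp, ((disjoint_neighborFinset_of_isCompl hGH u).mono_left
          inter_subset_right).mono_right inter_subset_right⟩
    rw [card_insert_of_notMem (by simp)] at h₆
    simp only [SimpleGraph.card_neighborFinset_eq_degree] at h₄ h₆
    have := hH z
    have := hH c
    omega
  rw [sum_card_inter_neighborFinset_comm] at hlow
  simp only [sum_add_distrib, sum_const, smul_eq_mul,
    SimpleGraph.card_neighborFinset_eq_degree] at hlow hupp
  have hδ := hH u
  have hkδ : k ≤ H.degree u := by
    obtain ⟨v, hv⟩ : (G.neighborFinset u).Nonempty := by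
      rw [← card_pos, SimpleGraph.card_neighborFinset_eq_degree]
      exact (Nat.zero_le _).trans_lt (hG u)
    rw [← SimpleGraph.card_neighborFinset_eq_degree]
    exact (hP (by simpa using hv) (hG u)).trans (card_le_card inter_subset_left)
  rw [← hdeg] at hk
  generalize H.degree u = x at *
  generalize G.degree u = y at *
  zify at *
  have : (0 : ℤ) ≤ (m₁ - x) * (2 * m₁ - k - 1) := mul_nonneg (by linarith) (by linarith)
  nlinarith

theorem lt_degree_of_adj (hGH : IsCompl G H) (hP : ManyCommonNeighbors G H m₁ k)
    (hQ : ManyCommonNeighbors H G m₁ k) (hsplit : ∀ v, G.degree v ≤ m₁ ∨ H.degree v ≤ m₁)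
    (hm : 2 * m₁ + 2 ≤ Fintype.card V) (hk : m₁ ^ 2 < k ^ 2 + k * m₁)
    {u z : V} (huz : G.Adj u z) (hu : H.degree u ≤ m₁) : m₁ < G.degree z := by
  by_contra! hz
  have hGu : m₁ < G.degree u := by
    have := degree_add_degree_of_isCompl hGH u
    omega
  have hHz : m₁ < H.degree z := by
    have := degree_add_degree_of_isCompl hGH z
    omega
  set C := H.neighborFinset u with hC
  set M := G.neighborFinset z with hM
  have hzC : z ∉ C := by
    simpa [hC] using huz.not_adj_of_isCompl hGH
  have hCcard : #C ≤ m₁ := by rwa [hC, SimpleGraph.card_neighborFinset_eq_degree]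
  have hMcard : #M ≤ m₁ := by rwa [hM, SimpleGraph.card_neighborFinset_eq_degree]
  have hCcard' : #(C \ M) + #(C ∩ M) = #C := card_sdiff_add_card_inter C M
  have hMcard' : #(M \ C) + #(C ∩ M) = #M := by
    rw [inter_comm]
    exact card_sdiff_add_card_inter M C
  have hCM : k ≤ #(C \ M) := by
    refine (hP huz hGu).trans (card_le_card fun x hx => ?_)
    rw [mem_inter] at hx
    exact mem_sdiff.2 ⟨hx.1, disjoint_right.1 (disjoint_neighborFinset_of_isCompl hGH z) hx.2⟩
  have hdeg_split : ∀ (K : SimpleGraph V) [DecidableRel K.Adj] (x : V) (S T : Finset V),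
      #(K.neighborFinset x ∩ S) = #(K.neighborFinset x ∩ (S \ T)) +
        #(K.neighborFinset x ∩ (S ∩ T)) := by
    intro K _ x S T
    rw [← card_union_of_disjoint, ← inter_union_distrib_left, sdiff_union_inter]
    exact ((disjoint_sdiff_inter S T).mono_left inter_subset_right).mono_right inter_subset_right
  have hC_M : #(C \ M) * k ≤ ∑ w ∈ C \ M, #(G.neighborFinset w ∩ (M \ C)) +
      ∑ w ∈ C \ M, #(G.neighborFinset w ∩ (C ∩ M)) := by
    rw [← sum_add_distrib, ← smul_eq_mul]
    refine card_nsmul_le_sum _ _ _ fun w hw => ?_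
    rw [inter_comm C M, ← hdeg_split, inter_comm]
    rw [mem_sdiff] at hw
    refine hQ ((SimpleGraph.adj_or_adj_of_isCompl hGH ?_).resolve_left ?_) hHz
    · rintro rfl
      exact hzC hw.1
    · simpa [hM] using hw.2
  have hM_C : #(M \ C) * k ≤ ∑ v ∈ M \ C, #(H.neighborFinset v ∩ (C \ M)) +
      ∑ v ∈ M \ C, #(H.neighborFinset v ∩ (C ∩ M)) := by
    rw [← sum_add_distrib, ← smul_eq_mul]
    refine card_nsmul_le_sum _ _ _ fun v hv => ?_
    rw [← hdeg_split, inter_comm]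
    rw [mem_sdiff] at hv
    by_cases hvu : u = v
    · subst hvu
      rw [← hC, inter_self]
      omega
    · refine hP ((SimpleGraph.adj_or_adj_of_isCompl hGH hvu).resolve_right ?_) hGu
      simpa [hC] using hv.2
  have hpair : ∑ v ∈ M \ C, #(G.neighborFinset v ∩ (C \ M)) +
      ∑ v ∈ M \ C, #(H.neighborFinset v ∩ (C \ M)) ≤ #(M \ C) * #(C \ M) := by
    rw [← sum_add_distrib, ← smul_eq_mul]
    refine sum_le_card_nsmul _ _ _ fun v _ => ?_
    rw [← card_union_of_disjoint]
    · exact card_le_card (union_subset inter_subset_right inter_subset_right)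
    · exact ((disjoint_neighborFinset_of_isCompl hGH v).mono_left
        inter_subset_left).mono_right inter_subset_left
  have hmid : ∑ f ∈ C ∩ M, (#(G.neighborFinset f ∩ (C \ M)) +
      #(H.neighborFinset f ∩ (M \ C)) + k + #(C ∩ M)) ≤ #(C ∩ M) * (2 * m₁) := by
    refine (sum_le_card_nsmul _ _ (2 * m₁) fun f hf => ?_).trans_eq (smul_eq_mul _ _)
    rw [mem_inter] at hf
    have hfu : H.Adj f u := by
      have := hf.1
      rw [hC, SimpleGraph.mem_neighborFinset] at this
      exact this.symm
    have hfz : G.Adj f z := by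
      have := hf.2
      rw [hM, SimpleGraph.mem_neighborFinset] at this
      exact this.symm
    have hdeg := degree_add_degree_of_isCompl hGH f
    have h₁ : #(G.neighborFinset f ∩ (C \ M)) ≤ #(C \ M) := card_le_card inter_subset_right
    have h₂ : #(H.neighborFinset f ∩ (M \ C)) ≤ #(M \ C) := card_le_card inter_subset_right
    rcases hsplit f with hf' | hf'
    · have h₃ := hQ hfu (by omega)
      have h₄ : #(G.neighborFinset f ∩ (C \ M)) + #(G.neighborFinset f ∩ G.neighborFinset u) ≤
          #(G.neighborFinset f) := by
        rw [← card_union_of_disjoint]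
        · exact card_le_card (union_subset inter_subset_left inter_subset_left)
        · exact ((disjoint_neighborFinset_of_isCompl hGH u).symm.mono_left
            (inter_subset_right.trans sdiff_subset)).mono_right inter_subset_right
      rw [SimpleGraph.card_neighborFinset_eq_degree] at h₄
      omega
    · have h₃ := hP hfz (by omega)
      have h₄ : #(H.neighborFinset f ∩ (M \ C)) + #(H.neighborFinset f ∩ H.neighborFinset z) ≤
          #(H.neighborFinset f) := by
        rw [← card_union_of_disjoint]
        · exact card_le_card (union_subset inter_subset_left inter_subset_left)
        · exact ((disjoint_neighborFinset_of_isCompl hGH z).mono_left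
            (inter_subset_right.trans sdiff_subset)).mono_right inter_subset_right
      rw [SimpleGraph.card_neighborFinset_eq_degree] at h₄
      omega
  rw [sum_card_inter_neighborFinset_comm (C \ M) (M \ C),
    sum_card_inter_neighborFinset_comm (C \ M) (C ∩ M)] at hC_M
  rw [sum_card_inter_neighborFinset_comm (M \ C) (C ∩ M)] at hM_C
  simp only [sum_add_distrib, sum_const, smul_eq_mul] at hmid
  have hcount : (#(C \ M) + #(M \ C)) * k + #(C ∩ M) * (k + #(C ∩ M)) ≤
      #(M \ C) * #(C \ M) + #(C ∩ M) * (2 * m₁) := by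
    linarith
  have hd : #(C \ M) + #(C ∩ M) ≤ m₁ := by omega
  have he : #(M \ C) + #(C ∩ M) ≤ m₁ := by omega
  generalize #(C \ M) = d at *
  generalize #(M \ C) = e at *
  generalize #(C ∩ M) = f at *
  clear_value C M
  zify at *
  have hprod : ((d : ℤ) - k) * (e - k) ≤ (m₁ - f - k) ^ 2 := by
    rcases le_total (e : ℤ) k with h | h
    · nlinarith [sq_nonneg ((m₁ : ℤ) - f - k)]
    · nlinarith
  nlinarith

end DoubleStarRamsey

theorem contains_doubleStar_of_quadratic_le {V : Type*} [Fintype V] {G H : SimpleGraph V}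
    {m₁ m₂ N : ℕ} (hm₁ : 0 < m₁) (hm₂ : 0 < m₂) (hlow : m₂ ^ 2 + m₁ * m₂ < m₁ ^ 2)
    (hup : m₁ < 3 * m₂)
    (hN : m₂ ≤ 2 * N) (hquad : (m₁ : ℤ) * (3 * m₁ + m₂) ≤ N * (N - m₂))
    (hGH : IsCompl G H) (hcard : Fintype.card V = N + 1) :
    Contains G (DoubleStar m₁ m₂) ∨ Contains H (DoubleStar m₁ m₂) := by
  classical
  by_contra! hno
  obtain ⟨hG, hH⟩ := hno
  have hN₁ : 2 * m₁ + 1 ≤ N := by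
    by_contra! h
    zify at *
    nlinarith
  have hN₂ : m₁ + 2 * m₂ + 1 ≤ N := by
    by_contra! h
    zify at *
    nlinarith
  obtain ⟨k, rfl⟩ : ∃ k, N = m₁ + m₂ + k := Nat.exists_eq_add_of_le (by omega)
  have hk : 2 * m₁ ^ 2 ≤ (m₁ + m₂ + k + m₁) * k := by
    zify at *
    nlinarith
  have hk_gold : m₁ ^ 2 < k ^ 2 + k * m₁ := by
    by_contra! h
    have h₁ : m₁ ^ 2 ≤ k * (m₁ + m₂) := by nlinarith
    zify at *
    nlinarith
  have hP : ManyCommonNeighbors G H m₁ k := fun u v huv hu =>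
    le_card_inter_neighborFinset hm₁ hGH hG hH (by omega) hcard.symm huv hu
  have hQ : ManyCommonNeighbors H G m₁ k := fun u v huv hu =>
    le_card_inter_neighborFinset hm₁ hGH.symm hH hG (by omega) hcard.symm huv hu
  have hsplit := degree_le_or_degree_le hGH hP hQ (by omega)
  have : Nonempty V := Fintype.card_pos_iff.1 (by omega)
  obtain ⟨u, hu⟩ := exists_lt_degree_of_manyCommonNeighbors hGH.symm hQ (by omega)
    (by rw [hcard]; linarith) (by omega)
  obtain ⟨z, hz⟩ := exists_lt_degree_of_manyCommonNeighbors hGH hP (by omega)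
    (by rw [hcard]; linarith) (by omega)
  have hu' := (hsplit u).resolve_left hu.not_ge
  have hz' := (hsplit z).resolve_right hz.not_ge
  have huz : u ≠ z := by
    rintro rfl
    omega
  rcases SimpleGraph.adj_or_adj_of_isCompl hGH huz with h | h
  · exact (lt_degree_of_adj hGH hP hQ hsplit (by omega) hk_gold h hu').not_ge hz'
  · exact (lt_degree_of_adj hGH.symm hQ hP (fun v => (hsplit v).symm) (by omega) hk_gold
      h.symm hz').not_ge hu'

theorem stmt_0 (m₁ m₂ : ℕ) (hm₁ : 0 < m₁) (hm₂ : 0 < m₂)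
    (hlow : (Real.sqrt 5 + 1) / 2 * m₂ < m₁) (hup : m₁ < 3 * m₂) :
    (ramseyNumber (DoubleStar m₁ m₂) : ℤ) ≤
      ⌈Real.sqrt (2 * m₁ ^ 2 + (m₁ + m₂ / 2) ^ 2) + m₂ / 2⌉ + 1 := by
  have hm₁R : (0 : ℝ) < m₁ := by exact_mod_cast hm₁
  have hm₂R : (0 : ℝ) < m₂ := by exact_mod_cast hm₂
  have h5 : Real.sqrt 5 ^ 2 = 5 := Real.sq_sqrt (by norm_num)
  have h5' : 0 ≤ Real.sqrt 5 := Real.sqrt_nonneg 5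
  have hgold : (m₂ : ℝ) ^ 2 + m₁ * m₂ < m₁ ^ 2 := by
    nlinarith [mul_pos (sub_pos.2 hlow) hm₁R, mul_pos (sub_pos.2 hlow) hm₂R,
      mul_nonneg h5' hm₂R.le]
  set X : ℝ := Real.sqrt (2 * m₁ ^ 2 + (m₁ + m₂ / 2) ^ 2) + m₂ / 2 with hX
  have hX₀ : 0 ≤ X := by positivity
  obtain ⟨N, hN⟩ := Int.eq_ofNat_of_zero_le (Int.ceil_nonneg hX₀)
  have hNX : X ≤ N := by
    have := Int.le_ceil X
    rw [hN] at this
    exact_mod_cast this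
  have hsqrt : 2 * (m₁ : ℝ) ^ 2 + (m₁ + m₂ / 2) ^ 2 ≤ (N - m₂ / 2) ^ 2 := by
    have hle : Real.sqrt (2 * m₁ ^ 2 + (m₁ + m₂ / 2) ^ 2) ≤ N - m₂ / 2 := by linarith
    exact (Real.sqrt_le_left ((Real.sqrt_nonneg _).trans hle)).1 hle
  have hNm₂ : (m₂ : ℝ) ≤ 2 * N := by
    have := Real.sqrt_nonneg (2 * (m₁ : ℝ) ^ 2 + (m₁ + m₂ / 2) ^ 2)
    linarith
  have hquad : (m₁ : ℝ) * (3 * m₁ + m₂) ≤ N * (N - m₂) := by linarith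
  have hgold' : m₂ ^ 2 + m₁ * m₂ < m₁ ^ 2 := by exact_mod_cast hgold
  have hNm₂' : m₂ ≤ 2 * N := by exact_mod_cast hNm₂
  have hquad' : (m₁ : ℤ) * (3 * m₁ + m₂) ≤ N * (N - m₂) := by exact_mod_cast hquad
  rw [hN]
  suffices h : ramseyNumber (DoubleStar m₁ m₂) ≤ N + 1 by exact_mod_cast h
  exact Nat.sInf_le fun G => contains_doubleStar_of_quadratic_le hm₁ hm₂ hgold' hup hNm₂' hquad'
    (isCompl_compl (x := G)) (Fintype.card_fin _)
end

section
/- For every positive integer m, the two-colour Ramsey number of the double star S(2m, m) satisfies R(S(2m, m)) ≤ ⌈4.27492·m⌉ + 1. -/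
open SimpleGraph

theorem contains_doubleStar_of_card_le {V : Type*} [DecidableEq V] {G : SimpleGraph V}
    {m₁ m₂ : ℕ} {u v : V} (huv : G.Adj u v) {A B : Finset V}
    (hA : ∀ w ∈ A, G.Adj u w) (hB : ∀ w ∈ B, G.Adj v w) (hvA : v ∉ A) (huB : u ∉ B)
    (hAc : m₁ ≤ A.card) (hBc : m₂ ≤ B.card) (hAB : m₁ + m₂ ≤ (A ∪ B).card) :
    Contains G (DoubleStar m₁ m₂) := by
  obtain ⟨B', hB'B, hB'c, hAB'⟩ : ∃ B' ⊆ B, B'.card = m₂ ∧ m₁ ≤ (A \ B').card := by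
    by_cases h : m₂ ≤ (B \ A).card
    · obtain ⟨B', hB', hc⟩ := Finset.exists_subset_card_eq h
      refine ⟨B', hB'.trans Finset.sdiff_subset, hc, ?_⟩
      rwa [Finset.sdiff_eq_self_of_disjoint]
      exact Finset.disjoint_of_subset_right hB' Finset.disjoint_sdiff
    · obtain ⟨B', h₁, h₂, hc⟩ :=
        Finset.exists_subsuperset_card_eq (Finset.sdiff_subset (s := B) (t := A))
          (le_of_not_ge h) hBc
      refine ⟨B', h₂, hc, ?_⟩
      have hsub : A ∪ B ⊆ (A \ B') ∪ B' := by
        intro w hw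
        have := @h₁ w
        simp only [Finset.mem_union, Finset.mem_sdiff] at *
        tauto
      have := (Finset.card_le_card hsub).trans (Finset.card_union_le _ _)
      omega
  obtain ⟨A', hA'A, hA'c⟩ := Finset.exists_subset_card_eq hAB'
  have hdisj : ∀ w ∈ A', w ∉ B' := fun w hw => (Finset.mem_sdiff.1 (hA'A hw)).2
  have hA'A : ∀ w ∈ A', w ∈ A := fun w hw => (Finset.mem_sdiff.1 (hA'A hw)).1
  let a : Fin m₁ ≃ A' := (Finset.equivFinOfCardEq hA'c).symm
  let b : Fin m₂ ≃ B' := (Finset.equivFinOfCardEq hB'c).symm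
  let f : Fin (m₁ + m₂ + 2) → V := fun i =>
    if h₀ : i.val = 0 then u else if h₁ : i.val = 1 then v else
    if h₂ : i.val < m₁ + 2 then a ⟨i.val - 2, by omega⟩
    else b ⟨i.val - (m₁ + 2), by omega⟩
  have hua : ∀ i, u ≠ a i := fun i => (hA _ (hA'A _ (a i).2)).ne
  have hva : ∀ i, v ≠ a i := fun i h => hvA (h ▸ hA'A _ (a i).2)
  have hub : ∀ i, u ≠ b i := fun i h => huB (h ▸ hB'B (b i).2)
  have hvb : ∀ i, v ≠ b i := fun i => (hB _ (hB'B (b i).2)).ne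
  have hab : ∀ i j, (a i : V) ≠ b j := fun i j h => hdisj _ (a i).2 (h ▸ (b j).2)
  have hf : ∀ i : Fin (m₁ + m₂ + 2), (i.val = 0 ∧ f i = u) ∨ (i.val = 1 ∧ f i = v) ∨
      (∃ k : Fin m₁, i.val = k.val + 2 ∧ f i = a k) ∨
      ∃ k : Fin m₂, i.val = k.val + (m₁ + 2) ∧ f i = b k := by
    intro i
    by_cases h₀ : i.val = 0
    · exact Or.inl ⟨h₀, dif_pos h₀⟩
    by_cases h₁ : i.val = 1
    · exact Or.inr (Or.inl ⟨h₁, by simp only [f]; rw [dif_neg h₀, dif_pos h₁]⟩)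
    by_cases h₂ : i.val < m₁ + 2
    · exact Or.inr (Or.inr (Or.inl ⟨⟨i.val - 2, by omega⟩, by simp only; omega,
        by simp only [f]; rw [dif_neg h₀, dif_neg h₁, dif_pos h₂]⟩))
    · exact Or.inr (Or.inr (Or.inr ⟨⟨i.val - (m₁ + 2), by omega⟩, by simp only; omega,
        by simp only [f]; rw [dif_neg h₀, dif_neg h₁, dif_neg h₂]⟩))
  have hadj : ∀ i j : Fin (m₁ + m₂ + 2),
      (i.val = 0 ∧ 0 < j.val ∧ j.val < m₁ + 2) ∨ (i.val = 1 ∧ m₁ + 2 ≤ j.val) →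
        G.Adj (f i) (f j) := by
    intro i j hij
    rcases hf i with ⟨hi, ei⟩ | ⟨hi, ei⟩ | ⟨k, hi, ei⟩ | ⟨k, hi, ei⟩ <;>
      rcases hf j with ⟨hj, ej⟩ | ⟨hj, ej⟩ | ⟨l, hj, ej⟩ | ⟨l, hj, ej⟩ <;>
      rw [ei, ej] <;>
      first
      | omega
      | exact huv
      | exact hA _ (hA'A _ (a l).2)
      | exact hB _ (hB'B (b l).2)
  refine ⟨⟨f, ?_⟩, ?_⟩
  · intro i j hij
    rcases ((SimpleGraph.fromRel_adj _ _ _).1 hij).2 with h | h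
    · exact hadj i j h
    · exact (hadj j i h).symm
  · intro i j hij
    change f i = f j at hij
    rcases hf i with ⟨hi, ei⟩ | ⟨hi, ei⟩ | ⟨k, hi, ei⟩ | ⟨k, hi, ei⟩ <;>
      rcases hf j with ⟨hj, ej⟩ | ⟨hj, ej⟩ | ⟨l, hj, ej⟩ | ⟨l, hj, ej⟩ <;>
      rw [ei, ej] at hij <;>
      first
      | exact Fin.ext (hi.trans hj.symm)
      | exact absurd hij huv.ne
      | exact absurd hij.symm huv.ne
      | exact absurd hij (hua _)
      | exact absurd hij.symm (hua _)
      | exact absurd hij (hva _)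
      | exact absurd hij.symm (hva _)
      | exact absurd hij (hub _)
      | exact absurd hij.symm (hub _)
      | exact absurd hij (hvb _)
      | exact absurd hij.symm (hvb _)
      | exact absurd hij (hab _ _)
      | exact absurd hij.symm (hab _ _)
      | (obtain rfl := a.injective (Subtype.ext hij)
         exact Fin.ext (hi.trans hj.symm))
      | (obtain rfl := b.injective (Subtype.ext hij)
         exact Fin.ext (hi.trans hj.symm))

theorem card_union_neighborFinset_le {V : Type*} [Fintype V] [DecidableEq V]
    {G : SimpleGraph V} [DecidableRel G.Adj] {m₁ m₂ : ℕ}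
    (hG : ¬ Contains G (DoubleStar m₁ m₂)) {u v : V} (huv : G.Adj u v)
    (hu : m₁ + 1 ≤ G.degree u) (hv : m₂ + 1 ≤ G.degree v) :
    (G.neighborFinset u ∪ G.neighborFinset v).card ≤ m₁ + m₂ + 1 := by
  by_contra! hlt
  refine hG (contains_doubleStar_of_card_le huv (A := (G.neighborFinset u).erase v)
    (B := (G.neighborFinset v).erase u) (by simp) (by simp) (by simp) (by simp) ?_ ?_ ?_)
  · rw [Finset.card_erase_of_mem (by simpa using huv), G.card_neighborFinset_eq_degree]; omega
  · rw [Finset.card_erase_of_mem (by simpa using huv.symm), G.card_neighborFinset_eq_degree]; omega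
  · have hsub : G.neighborFinset u ∪ G.neighborFinset v ⊆
        insert u (insert v ((G.neighborFinset u).erase v ∪ (G.neighborFinset v).erase u)) := by
      intro w hw
      simp only [Finset.mem_union, Finset.mem_insert, Finset.mem_erase] at *
      tauto
    have := Finset.card_le_card hsub
    have := Finset.card_insert_le u
      (insert v ((G.neighborFinset u).erase v ∪ (G.neighborFinset v).erase u))
    have := Finset.card_insert_le v ((G.neighborFinset u).erase v ∪ (G.neighborFinset v).erase u)
    omega

theorem false_of_edge_count_bounds {x y z b q s : ℝ} (hx : 0.9 ≤ x) (hxy : x ≤ y) (hz : 0 ≤ z)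
    (hxyz : 4.27492 ≤ x + y + z) (hb : 0.9 ≤ b) (hq : 0 ≤ q) (hqb : 18 ≤ 11 * q + 9 * b)
    (hyb : y ≤ 2 + b ∨ q = 0) (hs₁ : b * y ≤ s) (hs₂ : b * y + q * (y - 2 * b) ≤ s)
    (h : x * y + 4 / 3 * z ≤ 1.1 * x + 2 * y - s) : False := by
  rcases le_or_gt y (2 * b) with hy | hy
  · have hsy : y * y / 2 ≤ s := by nlinarith
    rcases le_or_gt y (73 / 30) with hy' | hy'
    · nlinarith [mul_nonneg (sub_nonneg.2 hxy) (sub_nonneg.2 hy'), sq_nonneg (y - 1.922)]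
    · nlinarith [mul_nonneg (sub_nonneg.2 hx) (sub_nonneg.2 hy'.le), sq_nonneg (y - 73 / 30)]
  · rcases hyb with hyb | rfl
    · have hs : 1.8 * y - 1.62 + 2 / 11 * ((b - 0.9) * (y - 1.8)) +
        18 / 11 * (b - 0.9) ^ 2 ≤ s := by
        nlinarith [mul_nonneg (sub_nonneg.2 hqb) (sub_nonneg.2 hy.le)]
      have h₀ := mul_nonneg (sub_nonneg.2 hb) (show (0 : ℝ) ≤ y - 1.8 by linarith)
      have h₁ := sq_nonneg (b - 0.9)
      rcases le_or_gt y (73 / 30) with hy' | hy'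
      · nlinarith only [h, hs, h₀, h₁, hxyz, mul_nonneg (sub_nonneg.2 hxy) (sub_nonneg.2 hy'),
          sq_nonneg (y - 1.983)]
      · have h₂ := mul_nonneg (sub_nonneg.2 hx) (sub_nonneg.2 hy'.le)
        have h₃ : 0.63334 * y < 1.889 +
            (2 / 11 * ((b - 0.9) * (y - 1.8)) + 18 / 11 * (b - 0.9) ^ 2) := by
          rcases le_or_gt y 2.95 with hy2 | hy2
          · linarith
          · have h3 : y - 2.9 ≤ b - 0.9 := by linarith
            have h4 : (y - 2.9) * (y - 1.8) ≤ (b - 0.9) * (y - 1.8) :=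
              mul_le_mul_of_nonneg_right h3 (by linarith)
            have h5 : (y - 2.9) ^ 2 ≤ (b - 0.9) ^ 2 := pow_le_pow_left₀ (by linarith) h3 2
            nlinarith only [h4, h5, sq_nonneg (y - 3.019)]
        nlinarith only [h, hs, h₂, h₃, hxyz, hy']
    · nlinarith

theorem le_of_local_inequality {m N β b q : ℝ} (hm : 0 < m) (hN : 4.27492 * m ≤ N)
    (hβ : β ≤ 2 * m) (hbβ : b ≤ β) (hq : 0 ≤ q) (hqb : q ≤ b)
    (h : (N - 3 * m) * (N - β) ≤
      (β - b) * (3 * m - β) + q * (2 * m) + (b - q) * (10 * m - 2 * N)) :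
    18 * m ≤ 11 * q + 9 * b := by
  obtain ⟨e, rfl⟩ : ∃ e, N = 4.27492 * m + e := ⟨N - 4.27492 * m, by ring⟩
  obtain ⟨s, rfl⟩ : ∃ s, β = 2 * m - s := ⟨2 * m - β, by ring⟩
  obtain ⟨r, rfl⟩ : ∃ r, b = q + r := ⟨b - q, by ring⟩
  have he : 0 ≤ e := by linarith
  have hs : 0 ≤ s := by linarith
  have hr : 0 ≤ r := by linarith
  by_contra! hlt
  nlinarith [mul_nonneg he hr, mul_nonneg he hs, mul_nonneg hs hq, mul_nonneg hs hr,
    mul_nonneg he hm.le, mul_nonneg hs hm.le, mul_pos hm (sub_pos.2 hlt), mul_pos hm hm,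
    mul_nonneg hm.le (sub_nonneg.2 hbβ)]

theorem le_of_local_inequality' {m N β b q : ℝ} (hm : 0 < m) (hN : 4.27492 * m ≤ N)
    (hβ : 2 * m ≤ β) (hqb : q ≤ b)
    (h : (N - 3 * m) * (N - β) ≤
      (β - b) * (3 * m - β) + q * (2 * m) + (b - q) * (10 * m - 2 * N)) :
    2 * m ≤ 3 * b := by
  have h₁ : (N - 3 * m) * (N - β) ≤ (β - b) * (3 * m - β) + b * (2 * m) := by
    nlinarith [mul_nonneg (sub_nonneg.2 hqb) (sub_nonneg.2 hN),
      mul_nonneg (sub_nonneg.2 hqb) hm.le]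
  by_contra! hb
  nlinarith [mul_nonneg (sub_nonneg.2 hN) hm.le, mul_nonneg (sub_nonneg.2 hN) (sub_nonneg.2 hN),
    mul_pos hm hm, sq_nonneg (2 * β - N - 2 / 3 * m),
    mul_pos (sub_pos.2 hb) (show 0 < β - m by linarith)]

/-- A pair of complementary graphs on `N + 1` vertices, the colour classes of a colouring with no
monochromatic double star `S(2m, m)`: in either graph, a vertex of degree more than `2m` and a
neighbour of degree more than `m` have fewer than `3m + 2` neighbours in total. -/
structure IsStarFreePair {V : Type*} [Fintype V] [DecidableEq V] (G H : SimpleGraph V)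
    [DecidableRel G.Adj] [DecidableRel H.Adj] (m N : ℕ) : Prop where
  adj_iff : ∀ u v, H.Adj u v ↔ u ≠ v ∧ ¬ G.Adj u v
  card_eq : Fintype.card V = N + 1
  pos : 0 < m
  le_card : (4.27492 : ℝ) * m ≤ N
  left : ∀ u v, G.Adj u v → 2 * m + 1 ≤ G.degree u → m + 1 ≤ G.degree v →
    (G.neighborFinset u ∪ G.neighborFinset v).card ≤ 3 * m + 1
  right : ∀ u v, H.Adj u v → 2 * m + 1 ≤ H.degree u → m + 1 ≤ H.degree v →
    (H.neighborFinset u ∪ H.neighborFinset v).card ≤ 3 * m + 1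

theorem SimpleGraph.sum_card_neighborFinset_inter_comm {V : Type*} [Fintype V] [DecidableEq V]
    (G : SimpleGraph V) [DecidableRel G.Adj] (S T : Finset V) :
    ∑ v ∈ S, (G.neighborFinset v ∩ T).card = ∑ v ∈ T, (G.neighborFinset v ∩ S).card := by
  have h : ∀ (A : Finset V) (v : V), (G.neighborFinset v ∩ A).card =
      ∑ w ∈ A, if G.Adj v w then 1 else 0 := by
    intro A v
    rw [← Finset.card_filter]
    congr 1
    ext w
    simp [and_comm]
  simp only [h]
  rw [Finset.sum_comm]
  simp only [G.adj_comm]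

namespace IsStarFreePair

variable {V : Type*} [Fintype V] [DecidableEq V] {G H : SimpleGraph V}
  [DecidableRel G.Adj] [DecidableRel H.Adj] {m N : ℕ}

theorem symm (P : IsStarFreePair G H m N) : IsStarFreePair H G m N where
  adj_iff u v := by
    have := P.adj_iff u v
    have := @SimpleGraph.Adj.ne V G u v
    tauto
  card_eq := P.card_eq
  pos := P.pos
  le_card := P.le_card
  left := P.right
  right := P.left

theorem four_mul_lt (P : IsStarFreePair G H m N) : 4 * m + 1 ≤ N := by
  have h := P.le_card
  have hm : (0 : ℝ) < m := by exact_mod_cast P.pos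
  have : (4 * m : ℝ) < N := by linarith
  exact_mod_cast this

theorem card_inter_add_card_inter (P : IsStarFreePair G H m N) {S : Finset V} {v : V}
    (hv : v ∉ S) : (G.neighborFinset v ∩ S).card + (H.neighborFinset v ∩ S).card = S.card := by
  rw [← Finset.card_union_of_disjoint]
  · congr 1
    ext w
    have := P.adj_iff v w
    by_cases hw : v = w
    · subst hw
      simp [hv]
    · simp only [Finset.mem_union, Finset.mem_inter, SimpleGraph.mem_neighborFinset]
      tauto
  · rw [Finset.disjoint_left]
    intro w hw hw'
    simp only [Finset.mem_inter, SimpleGraph.mem_neighborFinset, P.adj_iff] at hw hw'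
    tauto

theorem degree_add_degree (P : IsStarFreePair G H m N) (v : V) :
    G.degree v + H.degree v = N := by
  have h := P.card_inter_add_card_inter (S := Finset.univ.erase v) (v := v) (by simp)
  rw [Finset.card_erase_of_mem (Finset.mem_univ v), Finset.card_univ, P.card_eq] at h
  rw [Finset.inter_eq_left.2, Finset.inter_eq_left.2] at h
  · simpa using h
  all_goals
    intro w hw
    simpa using SimpleGraph.ne_of_adj _ ((SimpleGraph.mem_neighborFinset _ _ _).1 hw).symm

theorem degree_le (P : IsStarFreePair G H m N) (v : V) : G.degree v ≤ 3 * m := by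
  have aux : ∀ {G H : SimpleGraph V} [DecidableRel G.Adj] [DecidableRel H.Adj],
      IsStarFreePair G H m N → ∀ u w, G.Adj u w → 3 * m + 1 ≤ G.degree u → G.degree w ≤ m := by
    intro G H _ _ P u w huw hu
    by_contra! hw
    have h := P.left u w huw (by omega) hw
    have hsub : insert u (G.neighborFinset u) ⊆ G.neighborFinset u ∪ G.neighborFinset w := by
      intro z hz
      rcases Finset.mem_insert.1 hz with rfl | hz
      · simp [huw.symm]
      · exact Finset.mem_union_left _ hz
    have := Finset.card_le_card hsub
    rw [Finset.card_insert_of_notMem (by simp), G.card_neighborFinset_eq_degree] at this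
    omega
  by_contra! hv
  have hN := P.four_mul_lt
  have hm := P.pos
  have hH : ∀ w, G.Adj v w → 3 * m + 1 ≤ H.degree w := by
    intro w hw
    have := aux P v w hw hv
    have := P.degree_add_degree w
    omega
  obtain ⟨w, hw⟩ : (G.neighborFinset v).Nonempty := by
    rw [← Finset.card_pos, G.card_neighborFinset_eq_degree]
    omega
  rw [SimpleGraph.mem_neighborFinset] at hw
  have hsub : (G.neighborFinset v).erase w ⊆ G.neighborFinset w := by
    intro z hz
    rw [Finset.mem_erase, SimpleGraph.mem_neighborFinset] at hz
    rw [SimpleGraph.mem_neighborFinset]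
    by_contra hwz
    have := aux P.symm w z ((P.adj_iff w z).2 ⟨hz.1.symm, hwz⟩) (hH w hw)
    have := hH z hz.2
    omega
  have h₁ := Finset.card_le_card hsub
  rw [Finset.card_erase_of_mem (by simpa using hw), G.card_neighborFinset_eq_degree,
    G.card_neighborFinset_eq_degree] at h₁
  have := aux P v w hw hv
  omega

theorem le_card_inter (P : IsStarFreePair G H m N) {u v : V} (huv : G.Adj u v)
    (hu : 2 * m + 1 ≤ G.degree u) :
    N ≤ (H.neighborFinset u ∩ H.neighborFinset v).card + 3 * m := by
  have hv : m + 1 ≤ G.degree v := by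
    have := P.symm.degree_le v
    have := P.degree_add_degree v
    have := P.four_mul_lt
    omega
  have h := P.left u v huv hu hv
  have heq : H.neighborFinset u ∩ H.neighborFinset v =
      (G.neighborFinset u ∪ G.neighborFinset v)ᶜ := by
    ext w
    have h₁ := huv.ne
    simp only [Finset.mem_inter, Finset.mem_compl, Finset.mem_union,
      SimpleGraph.mem_neighborFinset, P.adj_iff]
    constructor
    · tauto
    · intro hw
      refine ⟨⟨?_, by tauto⟩, ⟨?_, by tauto⟩⟩
      · rintro rfl
        exact hw (Or.inr huv.symm)
      · rintro rfl
        exact hw (Or.inl huv)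
  rw [heq, Finset.card_compl, P.card_eq]
  omega

theorem mul_degree_le_sum (P : IsStarFreePair G H m N) {v : V}
    (hv : 2 * m + 1 ≤ G.degree v) :
    ((N : ℝ) - 3 * m) * G.degree v ≤
      ∑ w ∈ H.neighborFinset v, ((H.neighborFinset w ∩ G.neighborFinset v).card : ℝ) := by
  have h : ∀ u ∈ G.neighborFinset v,
      (N : ℝ) - 3 * m ≤ ((H.neighborFinset u ∩ H.neighborFinset v).card : ℝ) := by
    intro u hu
    have := P.le_card_inter ((SimpleGraph.mem_neighborFinset _ _ _).1 hu) hv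
    rw [Finset.inter_comm] at this
    rw [sub_le_iff_le_add]
    exact_mod_cast this
  have := Finset.card_nsmul_le_sum _ _ _ h
  rw [nsmul_eq_mul, G.card_neighborFinset_eq_degree, mul_comm] at this
  refine this.trans (le_of_eq ?_)
  exact_mod_cast H.sum_card_neighborFinset_inter_comm _ _

theorem card_inter_add_card_inter_le_degree (P : IsStarFreePair G H m N) (v w : V) :
    (H.neighborFinset w ∩ G.neighborFinset v).card +
      (H.neighborFinset w ∩ H.neighborFinset v).card ≤ H.degree w := by
  rw [← Finset.card_union_of_disjoint, ← H.card_neighborFinset_eq_degree]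
  · exact Finset.card_le_card (Finset.union_subset Finset.inter_subset_left
      Finset.inter_subset_left)
  · rw [Finset.disjoint_left]
    intro z hz hz'
    simp only [Finset.mem_inter, SimpleGraph.mem_neighborFinset, P.adj_iff] at hz hz'
    tauto

theorem card_inter_add_degree_le (P : IsStarFreePair G H m N) {v w : V} (hvw : H.Adj v w)
    (hw : 2 * m + 1 ≤ H.degree w) :
    (H.neighborFinset w ∩ G.neighborFinset v).card + H.degree v ≤ 3 * m := by
  have h₁ := P.card_inter_add_card_inter (S := G.neighborFinset v) (v := w)
    (by simpa using ((P.adj_iff v w).1 hvw).2)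
  have h₂ := P.symm.le_card_inter hvw.symm hw
  have h₃ := P.degree_add_degree v
  rw [G.card_neighborFinset_eq_degree] at h₁
  omega

theorem card_inter_add_le_of_common (P : IsStarFreePair G H m N) {u v w : V}
    (hv : 2 * m + 1 ≤ G.degree v) (hw : H.degree w ≤ 2 * m) (hu : H.degree u ≤ 2 * m)
    (hvu : G.Adj v u) (hwu : G.Adj w u) :
    (H.neighborFinset w ∩ G.neighborFinset v).card + 2 * N ≤ 10 * m := by
  have hw' : 2 * m + 1 ≤ G.degree w := by
    have := P.degree_add_degree w
    have := P.four_mul_lt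
    omega
  have h₁ := P.le_card_inter hvu hv
  have h₂ := P.le_card_inter hwu hw'
  have h₃ := Finset.card_union_add_card_inter (H.neighborFinset v ∩ H.neighborFinset u)
    (H.neighborFinset w ∩ H.neighborFinset u)
  have h₄ : (H.neighborFinset v ∩ H.neighborFinset u ∪
      H.neighborFinset w ∩ H.neighborFinset u).card ≤ H.degree u := by
    rw [← H.card_neighborFinset_eq_degree]
    exact Finset.card_le_card (Finset.union_subset Finset.inter_subset_right
      Finset.inter_subset_right)
  have h₅ : ((H.neighborFinset v ∩ H.neighborFinset u) ∩
      (H.neighborFinset w ∩ H.neighborFinset u)).card ≤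
        (H.neighborFinset w ∩ H.neighborFinset v).card := by
    refine Finset.card_le_card fun z hz => ?_
    simp only [Finset.mem_inter] at hz ⊢
    tauto
  have h₆ := P.card_inter_add_card_inter_le_degree v w
  omega

end IsStarFreePair

/-- The vertices of degree at most `2m`. -/
def SimpleGraph.lowDegree {V : Type*} [Fintype V] (H : SimpleGraph V) [DecidableRel H.Adj]
    (m : ℕ) : Finset V :=
  Finset.univ.filter fun v => H.degree v ≤ 2 * m

/-- The `H`-neighbours of `v` of low `H`-degree which have no `G`-neighbour of low `H`-degree in
common with `v`. -/
def SimpleGraph.separated {V : Type*} [Fintype V] [DecidableEq V] (G H : SimpleGraph V)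
    [DecidableRel G.Adj] [DecidableRel H.Adj] (m : ℕ) (v : V) : Finset V :=
  (H.neighborFinset v ∩ H.lowDegree m).filter
    fun w => ∀ u ∈ H.lowDegree m, G.Adj v u → ¬ G.Adj w u

namespace IsStarFreePair

variable {V : Type*} [Fintype V] [DecidableEq V] {G H : SimpleGraph V}
  [DecidableRel G.Adj] [DecidableRel H.Adj] {m N : ℕ}

theorem local_inequality (P : IsStarFreePair G H m N) {v : V} (hv : 2 * m + 1 ≤ G.degree v) :
    ((N : ℝ) - 3 * m) * (N - H.degree v) ≤
      (H.degree v - (H.neighborFinset v ∩ H.lowDegree m).card) * (3 * m - H.degree v) +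
      (G.separated H m v).card * (2 * m) +
      ((H.neighborFinset v ∩ H.lowDegree m).card - (G.separated H m v).card) *
        (10 * m - 2 * N) := by
  have hdeg : (G.degree v : ℝ) = N - H.degree v := by
    rw [← P.degree_add_degree v]
    push_cast
    ring
  have h := P.mul_degree_le_sum hv
  rw [hdeg] at h
  refine h.trans ?_
  set a : V → ℝ := fun w => ((H.neighborFinset w ∩ G.neighborFinset v).card : ℝ) with ha
  rw [← Finset.sum_sdiff (Finset.inter_subset_left (s₁ := H.neighborFinset v)
    (s₂ := H.lowDegree m)), ← Finset.sum_sdiff (s₁ := G.separated H m v)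
    (s₂ := H.neighborFinset v ∩ H.lowDegree m) (Finset.filter_subset _ _)]
  have h₁ : ∑ w ∈ H.neighborFinset v \ (H.neighborFinset v ∩ H.lowDegree m), a w ≤
      (H.degree v - (H.neighborFinset v ∩ H.lowDegree m).card) * (3 * m - H.degree v) := by
    have := Finset.sum_le_card_nsmul (H.neighborFinset v \ (H.neighborFinset v ∩ H.lowDegree m)) a
      (3 * m - H.degree v) fun w hw => by
        simp only [Finset.mem_sdiff, Finset.mem_inter, SimpleGraph.mem_neighborFinset,
          SimpleGraph.lowDegree, Finset.mem_filter, Finset.mem_univ, true_and, not_and] at hw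
        have := P.card_inter_add_degree_le hw.1 (by have := hw.2 hw.1; omega)
        rw [le_sub_iff_add_le]
        simp only [ha]
        exact_mod_cast this
    rwa [nsmul_eq_mul, Finset.cast_card_sdiff Finset.inter_subset_left,
      H.card_neighborFinset_eq_degree] at this
  have h₂ : ∑ w ∈ G.separated H m v, a w ≤ (G.separated H m v).card * (2 * m) := by
    rw [← nsmul_eq_mul]
    refine Finset.sum_le_card_nsmul _ _ _ fun w hw => ?_
    simp only [SimpleGraph.separated, Finset.mem_filter, Finset.mem_inter, SimpleGraph.lowDegree,
      Finset.mem_univ, true_and] at hw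
    have h₃ := P.card_inter_add_card_inter_le_degree v w
    have : (H.neighborFinset w ∩ G.neighborFinset v).card ≤ 2 * m := by omega
    simp only [ha]
    exact_mod_cast this
  have h₃ : ∑ w ∈ (H.neighborFinset v ∩ H.lowDegree m) \ G.separated H m v, a w ≤
      ((H.neighborFinset v ∩ H.lowDegree m).card - (G.separated H m v).card) *
        (10 * m - 2 * N) := by
    rw [← Finset.cast_card_sdiff (s := G.separated H m v) (Finset.filter_subset _ _),
      ← nsmul_eq_mul]
    refine Finset.sum_le_card_nsmul _ _ _ fun w hw => ?_
    simp only [SimpleGraph.separated, SimpleGraph.lowDegree, Finset.mem_sdiff, Finset.mem_inter,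
      SimpleGraph.mem_neighborFinset, Finset.mem_filter, Finset.mem_univ, true_and, not_and,
      not_forall, not_not] at hw
    obtain ⟨⟨hvw, hw⟩, hu⟩ := hw
    obtain ⟨u, hu, hvu, hwu⟩ := hu ⟨hvw, hw⟩
    have := P.card_inter_add_le_of_common hv hw hu hvu hwu
    rw [le_sub_iff_add_le]
    simp only [ha]
    exact_mod_cast this
  linarith

theorem card_separated_le (G H : SimpleGraph V) [DecidableRel G.Adj] [DecidableRel H.Adj]
    (m : ℕ) (v : V) :
    (G.separated H m v).card ≤ (H.neighborFinset v ∩ H.lowDegree m).card :=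
  Finset.card_le_card (Finset.filter_subset _ _)

theorem card_inter_lowDegree_le (H : SimpleGraph V) [DecidableRel H.Adj] (m : ℕ) (v : V) :
    (H.neighborFinset v ∩ H.lowDegree m).card ≤ H.degree v := by
  rw [← H.card_neighborFinset_eq_degree]
  exact Finset.card_le_card Finset.inter_subset_left

theorem le_of_mem_lowDegree (P : IsStarFreePair G H m N) {v : V} (hv : v ∈ H.lowDegree m) :
    18 * (m : ℝ) ≤ 11 * (G.separated H m v).card +
      9 * (H.neighborFinset v ∩ H.lowDegree m).card := by
  have hv' : H.degree v ≤ 2 * m := (Finset.mem_filter.1 hv).2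
  have hv'' : 2 * m + 1 ≤ G.degree v := by
    have := P.degree_add_degree v
    have := P.four_mul_lt
    omega
  refine le_of_local_inequality (by exact_mod_cast P.pos) P.le_card (by exact_mod_cast hv')
    (by exact_mod_cast card_inter_lowDegree_le H m v) (Nat.cast_nonneg _)
    (by exact_mod_cast card_separated_le G H m v) (P.local_inequality hv'')

theorem le_of_notMem_lowDegree (P : IsStarFreePair G H m N) {v : V} (hv : v ∉ G.lowDegree m)
    (hv' : v ∉ H.lowDegree m) :
    2 * (m : ℝ) ≤ 3 * (H.neighborFinset v ∩ H.lowDegree m).card := by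
  simp only [SimpleGraph.lowDegree, Finset.mem_filter, Finset.mem_univ, true_and, not_le] at hv hv'
  refine le_of_local_inequality' (by exact_mod_cast P.pos) P.le_card
    (by exact_mod_cast hv'.le) (by exact_mod_cast card_separated_le G H m v)
    (P.local_inequality hv)

theorem disjoint_lowDegree (P : IsStarFreePair G H m N) :
    Disjoint (G.lowDegree m) (H.lowDegree m) := by
  rw [Finset.disjoint_left]
  intro v hv hv'
  simp only [SimpleGraph.lowDegree, Finset.mem_filter, Finset.mem_univ, true_and] at hv hv'
  have := P.degree_add_degree v
  have := P.four_mul_lt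
  omega

theorem lowDegree_nonempty (P : IsStarFreePair G H m N) : (G.lowDegree m).Nonempty := by
  by_contra hX
  rw [Finset.not_nonempty_iff_eq_empty] at hX
  have hm : (0 : ℝ) < m := by exact_mod_cast P.pos
  have hN := P.le_card
  have hY : ∀ v, v ∈ H.lowDegree m := by
    intro v
    by_contra hv
    have := P.symm.le_of_notMem_lowDegree hv (by simp [hX])
    rw [hX, Finset.inter_empty, Finset.card_empty] at this
    norm_num at this
    linarith
  obtain ⟨v⟩ : Nonempty V := Fintype.card_pos_iff.1 (by rw [P.card_eq]; omega)
  have hdeg : ∀ w, H.degree w ≤ 2 * m := fun w => (Finset.mem_filter.1 (hY w)).2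
  have hsep : G.separated H m v = ∅ := by
    rw [Finset.eq_empty_iff_forall_notMem]
    intro w hw
    simp only [SimpleGraph.separated, Finset.mem_filter, Finset.mem_inter,
      SimpleGraph.mem_neighborFinset] at hw
    have hvw := ((P.adj_iff v w).1 hw.1.1)
    have hdisj : Disjoint (G.neighborFinset v) (G.neighborFinset w) := by
      rw [Finset.disjoint_left]
      intro u hu hu'
      rw [SimpleGraph.mem_neighborFinset] at hu hu'
      exact hw.2 u (hY u) hu hu'
    have := Finset.card_lt_univ_of_notMem (s := G.neighborFinset v ∪ G.neighborFinset w) (x := v)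
      (by simpa [G.adj_comm w v] using hvw.2)
    rw [Finset.card_union_of_disjoint hdisj, P.card_eq, G.card_neighborFinset_eq_degree,
      G.card_neighborFinset_eq_degree] at this
    have := P.degree_add_degree v
    have := P.degree_add_degree w
    have := hdeg v
    have := hdeg w
    have := P.four_mul_lt
    have := P.pos
    omega
  have h := P.local_inequality (v := v) (by
    have := P.degree_add_degree v
    have := hdeg v
    have := P.four_mul_lt
    omega)
  rw [hsep, Finset.inter_eq_left.2 fun w _ => hY w, H.card_neighborFinset_eq_degree,
    Finset.card_empty, Nat.cast_zero] at h
  have hβ : (H.degree v : ℝ) ≤ 2 * m := by exact_mod_cast hdeg v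
  nlinarith [mul_nonneg (sub_nonneg.2 hN) hm.le, mul_nonneg (sub_nonneg.2 hN) (sub_nonneg.2 hN),
    mul_nonneg (sub_nonneg.2 hN) (sub_nonneg.2 hβ), mul_nonneg hm.le (sub_nonneg.2 hβ),
    mul_pos hm hm]

theorem card_compl_lowDegree (P : IsStarFreePair G H m N) :
    ((G.lowDegree m ∪ H.lowDegree m)ᶜ.card : ℝ) =
      N + 1 - (G.lowDegree m).card - (H.lowDegree m).card := by
  have h := Finset.card_add_card_compl (G.lowDegree m ∪ H.lowDegree m)
  rw [Finset.card_union_of_disjoint P.disjoint_lowDegree, P.card_eq] at h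
  have h' : (((G.lowDegree m).card : ℝ) + (H.lowDegree m).card) +
      (G.lowDegree m ∪ H.lowDegree m)ᶜ.card = N + 1 := by
    exact_mod_cast h
  linarith

theorem le_card_inter_lowDegree (P : IsStarFreePair G H m N) {v : V} (hv : v ∈ H.lowDegree m) :
    0.9 * (m : ℝ) ≤ (H.neighborFinset v ∩ H.lowDegree m).card := by
  have h₁ := P.le_of_mem_lowDegree hv
  have h₂ : ((G.separated H m v).card : ℝ) ≤ (H.neighborFinset v ∩ H.lowDegree m).card := by
    exact_mod_cast card_separated_le G H m v
  linarith

theorem sum_card_inter_le (P : IsStarFreePair G H m N) :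
    (∑ v ∈ H.lowDegree m, ((H.neighborFinset v ∩ G.lowDegree m).card : ℝ)) +
      ∑ v ∈ H.lowDegree m, ((H.neighborFinset v ∩ H.lowDegree m).card : ℝ) +
      2 / 3 * m * (N + 1 - (G.lowDegree m).card - (H.lowDegree m).card) ≤
        2 * m * (H.lowDegree m).card := by
  have h₁ : ∀ z ∈ (G.lowDegree m ∪ H.lowDegree m)ᶜ,
      2 / 3 * (m : ℝ) ≤ (H.neighborFinset z ∩ H.lowDegree m).card := by
    intro z hz
    simp only [Finset.mem_compl, Finset.mem_union, not_or] at hz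
    linarith [P.le_of_notMem_lowDegree hz.1 hz.2]
  have h₂ := Finset.card_nsmul_le_sum _ _ _ h₁
  rw [nsmul_eq_mul, P.card_compl_lowDegree] at h₂
  have h₃ : ∑ z ∈ (G.lowDegree m ∪ H.lowDegree m)ᶜ,
        ((H.neighborFinset z ∩ H.lowDegree m).card : ℝ) =
      ∑ v ∈ H.lowDegree m,
        ((H.neighborFinset v ∩ (G.lowDegree m ∪ H.lowDegree m)ᶜ).card : ℝ) := by
    exact_mod_cast H.sum_card_neighborFinset_inter_comm _ _
  have h₄ : ∀ v ∈ H.lowDegree m, ((H.neighborFinset v ∩ G.lowDegree m).card : ℝ) +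
      (H.neighborFinset v ∩ H.lowDegree m).card +
      (H.neighborFinset v ∩ (G.lowDegree m ∪ H.lowDegree m)ᶜ).card ≤ 2 * m := by
    intro v hv
    have hd := (Finset.mem_filter.1 hv).2
    have e₁ := Finset.card_inter_add_card_sdiff (H.neighborFinset v)
      (G.lowDegree m ∪ H.lowDegree m)
    rw [Finset.inter_union_distrib_left, Finset.card_union_of_disjoint
      (P.disjoint_lowDegree.mono Finset.inter_subset_right Finset.inter_subset_right),
      Finset.sdiff_eq_inter_compl, H.card_neighborFinset_eq_degree] at e₁
    exact_mod_cast e₁.trans_le hd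
  have h₅ := Finset.sum_le_card_nsmul _ _ _ h₄
  rw [nsmul_eq_mul, Finset.sum_add_distrib, Finset.sum_add_distrib] at h₅
  linarith

theorem sum_card_inter_add_sum_card_inter (P : IsStarFreePair G H m N) :
    (∑ v ∈ H.lowDegree m, ((H.neighborFinset v ∩ G.lowDegree m).card : ℝ)) +
      ∑ v ∈ G.lowDegree m, ((G.neighborFinset v ∩ H.lowDegree m).card : ℝ) =
        (G.lowDegree m).card * (H.lowDegree m).card := by
  have h : ∑ v ∈ H.lowDegree m, (H.neighborFinset v ∩ G.lowDegree m).card +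
      ∑ v ∈ G.lowDegree m, (G.neighborFinset v ∩ H.lowDegree m).card =
        (G.lowDegree m).card * (H.lowDegree m).card := by
    rw [H.sum_card_neighborFinset_inter_comm, ← Finset.sum_add_distrib]
    refine Finset.sum_const_nat fun v hv => ?_
    rw [add_comm]
    exact P.card_inter_add_card_inter (Finset.disjoint_left.1 P.disjoint_lowDegree hv)
  exact_mod_cast h

theorem card_lowDegree_le_of_mem_separated (P : IsStarFreePair G H m N) {v w : V}
    (hw : w ∈ G.separated H m v) :
    (H.lowDegree m).card ≤ (H.neighborFinset v ∩ H.lowDegree m).card +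
      (H.neighborFinset w ∩ H.lowDegree m).card := by
  simp only [SimpleGraph.separated, Finset.mem_filter, Finset.mem_inter,
    SimpleGraph.mem_neighborFinset] at hw
  obtain ⟨⟨hvw, -⟩, hw⟩ := hw
  refine (Finset.card_le_card fun u hu => ?_).trans (Finset.card_union_le _ _)
  simp only [Finset.mem_union, Finset.mem_inter, SimpleGraph.mem_neighborFinset]
  by_cases huv : v = u
  · subst huv
    exact Or.inr ⟨hvw.symm, hu⟩
  by_cases hG : G.Adj v u
  · refine Or.inr ⟨(P.adj_iff _ _).2 ⟨?_, hw u hu hG⟩, hu⟩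
    rintro rfl
    exact ((P.adj_iff _ _).1 hvw).2 hG
  · exact Or.inl ⟨(P.adj_iff _ _).2 ⟨huv, hG⟩, hu⟩

theorem false_of_card_le (P : IsStarFreePair G H m N)
    (hXY : (G.lowDegree m).card ≤ (H.lowDegree m).card) : False := by
  have hm : (0 : ℝ) < m := by exact_mod_cast P.pos
  have hX := P.lowDegree_nonempty
  have hY := P.symm.lowDegree_nonempty
  obtain ⟨v, hv, hmin⟩ := Finset.exists_min_image (H.lowDegree m)
    (fun v => (H.neighborFinset v ∩ H.lowDegree m).card) hY
  have hx : 0.9 * (m : ℝ) ≤ (G.lowDegree m).card := by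
    obtain ⟨u, hu⟩ := hX
    refine (P.symm.le_card_inter_lowDegree hu).trans ?_
    exact_mod_cast Finset.card_le_card Finset.inter_subset_right
  have hb := P.le_card_inter_lowDegree hv
  have hqb := P.le_of_mem_lowDegree hv
  have hXX := Finset.card_nsmul_le_sum (G.lowDegree m)
    (fun v => ((G.neighborFinset v ∩ G.lowDegree m).card : ℝ)) _
    fun u hu => P.symm.le_card_inter_lowDegree hu
  have hflowY := P.sum_card_inter_le
  have hflowX := P.symm.sum_card_inter_le
  have hxy := P.sum_card_inter_add_sum_card_inter
  have hz : (0 : ℝ) ≤ N + 1 - (G.lowDegree m).card - (H.lowDegree m).card := by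
    rw [← P.card_compl_lowDegree]
    positivity
  have hN := P.le_card
  have hlow : ∀ w ∈ H.lowDegree m, ((H.neighborFinset v ∩ H.lowDegree m).card : ℝ) ≤
      (H.neighborFinset w ∩ H.lowDegree m).card := fun w hw => by exact_mod_cast hmin w hw
  have hs₁ := Finset.card_nsmul_le_sum _ _ _ hlow
  have hsub : G.separated H m v ⊆ H.lowDegree m :=
    (Finset.filter_subset _ _).trans Finset.inter_subset_right
  have hsep : ∀ w ∈ G.separated H m v, ((H.lowDegree m).card : ℝ) -
      (H.neighborFinset v ∩ H.lowDegree m).card ≤ (H.neighborFinset w ∩ H.lowDegree m).card := by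
    intro w hw
    rw [sub_le_iff_le_add']
    exact_mod_cast P.card_lowDegree_le_of_mem_separated hw
  have hs₂ := add_le_add
    (Finset.card_nsmul_le_sum (H.lowDegree m \ G.separated H m v) _ _ fun w hw =>
      hlow w (Finset.sdiff_subset hw)) (Finset.card_nsmul_le_sum _ _ _ hsep)
  rw [Finset.sum_sdiff hsub, nsmul_eq_mul, nsmul_eq_mul, Finset.cast_card_sdiff hsub] at hs₂
  have hyb : ((H.lowDegree m).card : ℝ) ≤ 2 * m + (H.neighborFinset v ∩ H.lowDegree m).card ∨
      ((G.separated H m v).card : ℝ) = 0 := by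
    rcases (G.separated H m v).eq_empty_or_nonempty with hQ | ⟨w, hw⟩
    · simp [hQ]
    · left
      have h₁ := P.card_lowDegree_le_of_mem_separated hw
      have h₂ := card_inter_lowDegree_le H m w
      have h₃ := (Finset.mem_filter.1 (hsub hw)).2
      have : (H.lowDegree m).card ≤ 2 * m + (H.neighborFinset v ∩ H.lowDegree m).card := by
        omega
      exact_mod_cast this
  rw [nsmul_eq_mul] at hs₁ hXX
  have hXY' : ((G.lowDegree m).card : ℝ) ≤ (H.lowDegree m).card := by exact_mod_cast hXY
  have hq : (0 : ℝ) ≤ (G.separated H m v).card := Nat.cast_nonneg _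
  generalize ((G.lowDegree m).card : ℝ) = x at *
  generalize ((H.lowDegree m).card : ℝ) = y at *
  generalize ((H.neighborFinset v ∩ H.lowDegree m).card : ℝ) = b at *
  generalize ((G.separated H m v).card : ℝ) = q at *
  generalize ∑ v ∈ H.lowDegree m, ((H.neighborFinset v ∩ H.lowDegree m).card : ℝ) = s at *
  obtain ⟨z, hz'⟩ : ∃ z : ℝ, z = N + 1 - x - y := ⟨_, rfl⟩
  rw [← hz'] at hz hflowY
  have hz'' : (N : ℝ) + 1 - y - x = z := by rw [hz']; ring
  rw [hz''] at hflowX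
  have key : x * y + 4 / 3 * (m * z) ≤ 1.1 * (m * x) + 2 * (m * y) - s := by linarith
  obtain ⟨x, rfl⟩ : ∃ t, x = m * t := ⟨x / m, by field_simp⟩
  obtain ⟨y, rfl⟩ : ∃ t, y = m * t := ⟨y / m, by field_simp⟩
  obtain ⟨z, rfl⟩ : ∃ t, z = m * t := ⟨z / m, by field_simp⟩
  obtain ⟨b, rfl⟩ : ∃ t, b = m * t := ⟨b / m, by field_simp⟩
  obtain ⟨q, rfl⟩ : ∃ t, q = m * t := ⟨q / m, by field_simp⟩
  obtain ⟨s, rfl⟩ : ∃ t, s = m * (m * t) := ⟨s / m / m, by field_simp⟩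
  refine false_of_edge_count_bounds (x := x) (y := y) (z := z) (b := b) (q := q) (s := s)
    ?_ ?_ ?_ ?_ ?_ ?_ ?_ ?_ ?_ ?_ ?_
  · exact le_of_mul_le_mul_left (by linarith) hm
  · exact le_of_mul_le_mul_left (by linarith) hm
  · exact le_of_mul_le_mul_left (by linarith) hm
  · exact le_of_mul_le_mul_left (by linarith) hm
  · exact le_of_mul_le_mul_left (by linarith) hm
  · exact le_of_mul_le_mul_left (by linarith) hm
  · exact le_of_mul_le_mul_left (by linarith) hm
  · exact hyb.imp (fun h => le_of_mul_le_mul_left (by linarith) hm)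
      fun h => (mul_eq_zero.1 h).resolve_left hm.ne'
  · exact le_of_mul_le_mul_left (le_of_mul_le_mul_left (by linarith) hm) hm
  · exact le_of_mul_le_mul_left (le_of_mul_le_mul_left (by linarith) hm) hm
  · exact le_of_mul_le_mul_left (le_of_mul_le_mul_left (by linarith) hm) hm

theorem elim (P : IsStarFreePair G H m N) : False :=
  (le_total _ _).elim P.false_of_card_le P.symm.false_of_card_le

end IsStarFreePair

theorem stmt_1 (m : ℕ) (hm : 0 < m) :
    (ramseyNumber (DoubleStar (2 * m) m) : ℤ) ≤ ⌈(4.27492 : ℝ) * m⌉ + 1 := by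
  have h : ramseyNumber (DoubleStar (2 * m) m) ≤ ⌈(4.27492 : ℝ) * m⌉₊ + 1 := by
    refine Nat.sInf_le fun G => ?_
    classical
    by_contra! hG
    refine IsStarFreePair.elim (G := G) (H := Gᶜ) (m := m) ⟨fun u v => G.compl_adj u v,
      Fintype.card_fin _, hm, Nat.le_ceil _, fun u v huv hu hv => ?_, fun u v huv hu hv => ?_⟩
    · exact (card_union_neighborFinset_le hG.1 huv hu hv).trans (by omega)
    · exact (card_union_neighborFinset_le hG.2 huv hu hv).trans (by omega)
  rw [← Int.natCast_ceil_eq_ceil (by positivity)]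
  exact_mod_cast h
end
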